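/- arXiv:2504.02749 — 10 statements merged into one kernel-verified Lean document; each statement's English description precedes it below -/
import Mathlib

section
/- The m·(n−1) + n·(m−1) Bacon-Shor check vectors (all horizontal XX checks H(i,j) and all vertical ZZ checks W(i,j)) are linearly independent over ZMod 2 in V; consequently the F₂-dimension of their span G equals n·(m−1) + m·(n−1). -/
open Finset

/-- The F₂-vector space of Pauli operators (mod phase) on the m×n grid:
first component is the X-support, second the Z-support. -/
abbrev V (m n : ℕ) := ((Fin m × Fin n) → ZMod 2) × ((Fin m × Fin n) → ZMod 2)

/-- Symplectic form: two Paulis commute iff `omega` of their vectors is 0. -/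
def omega {m n : ℕ} (v w : V m n) : ZMod 2 :=
  ∑ q : Fin m × Fin n, (v.1 q * w.2 q + w.1 q * v.2 q)

/-- Horizontal XX check H(i,j): X-part the indicator of {(i,j),(i+1,j)}
(here i ranges over Fin (m-1), i.e. 0 ≤ i ≤ m−2). -/
def Hcheck {m n : ℕ} (i : Fin (m - 1)) (j : Fin n) : V m n :=
  (fun q => if (q.1.val = i.val ∨ q.1.val = i.val + 1) ∧ q.2 = j then 1 else 0, 0)

/-- Vertical ZZ check W(i,j): Z-part the indicator of {(i,j),(i,j+1)}
(here j ranges over Fin (n-1), i.e. 0 ≤ j ≤ n−2). -/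
def Wcheck {m n : ℕ} (i : Fin m) (j : Fin (n - 1)) : V m n :=
  (0, fun q => if q.1 = i ∧ (q.2.val = j.val ∨ q.2.val = j.val + 1) then 1 else 0)

/-- The F₂-span G of all Bacon-Shor check vectors. -/
def checkSpan (m n : ℕ) : Submodule (ZMod 2) (V m n) :=
  Submodule.span (ZMod 2)
    ((Set.range fun p : Fin (m - 1) × Fin n => Hcheck p.1 p.2) ∪
     (Set.range fun p : Fin m × Fin (n - 1) => Wcheck p.1 p.2))

/-- `omega · w` as a linear map in the first argument. -/
def omegaR {m n : ℕ} (w : V m n) : V m n →ₗ[ZMod 2] ZMod 2 where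
  toFun v := omega v w
  map_add' a b := by
    simp only [omega, Prod.fst_add, Prod.snd_add, Pi.add_apply]
    rw [← Finset.sum_add_distrib]
    exact Finset.sum_congr rfl fun q _ => by ring
  map_smul' c a := by
    simp only [omega, Prod.smul_fst, Prod.smul_snd, Pi.smul_apply, smul_eq_mul,
      RingHom.id_apply, Finset.mul_sum]
    exact Finset.sum_congr rfl fun q _ => by ring

/-- The radical {v ∈ G : ∀ w ∈ G, ω(v,w) = 0} of the symplectic form on G. -/
def radical (m n : ℕ) : Submodule (ZMod 2) (V m n) :=
  checkSpan m n ⊓ ⨅ w ∈ checkSpan m n, LinearMap.ker (omegaR w)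

/-- The centralizer {v ∈ V : ∀ w ∈ G, ω(v,w) = 0} of the check span. -/
def centralizer (m n : ℕ) : Submodule (ZMod 2) (V m n) :=
  ⨅ w ∈ checkSpan m n, LinearMap.ker (omegaR w)

/-- Vertical X-type stabilizer S^X_i (i = 1,…,m−1 encoded as Fin (m-1) via i ↦ i−1):
X-part the indicator of {i−1,i} × Fin n. -/
def SX {m n : ℕ} (i : Fin (m - 1)) : V m n :=
  (fun q => if q.1.val = i.val ∨ q.1.val = i.val + 1 then 1 else 0, 0)

/-- Horizontal Z-type stabilizer S^Z_j (j = 1,…,n−1 encoded as Fin (n-1) via j ↦ j−1):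
Z-part the indicator of Fin m × {j−1,j}. -/
def SZ {m n : ℕ} (j : Fin (n - 1)) : V m n :=
  (0, fun q => if q.2.val = j.val ∨ q.2.val = j.val + 1 then 1 else 0)

/-- Logical X̄_L: X-part the indicator of {0} × Fin n. -/
def XL {m n : ℕ} : V m n :=
  (fun q => if q.1.val = 0 then 1 else 0, 0)

/-- Logical Z̄_L: Z-part the indicator of Fin m × {0}. -/
def ZL {m n : ℕ} : V m n :=
  (0, fun q => if q.2.val = 0 then 1 else 0)

/-- Gauge qubit X̄_{a,b} (1 ≤ a ≤ m−1, 1 ≤ b ≤ n−1, encoded as Fin (m-1) × Fin (n-1)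
via (a,b) ↦ (a−1,b−1)): X-part the indicator of {a−1,a} × {b,…,n−1}. -/
def gaugeX {m n : ℕ} (a : Fin (m - 1)) (b : Fin (n - 1)) : V m n :=
  (fun q => if (q.1.val = a.val ∨ q.1.val = a.val + 1) ∧ b.val + 1 ≤ q.2.val then 1 else 0, 0)

/-- Gauge qubit Z̄_{a,b}: Z-part the indicator of {a,…,m−1} × {b−1,b}. -/
def gaugeZ {m n : ℕ} (a : Fin (m - 1)) (b : Fin (n - 1)) : V m n :=
  (0, fun q => if a.val + 1 ≤ q.1.val ∧ (q.2.val = b.val ∨ q.2.val = b.val + 1) then 1 else 0)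

/-- Destabilizer D^X_j: X-part the indicator of {0} × {j,…,n−1}. -/
def DX {m n : ℕ} (j : Fin (n - 1)) : V m n :=
  (fun q => if q.1.val = 0 ∧ j.val + 1 ≤ q.2.val then 1 else 0, 0)

/-- Destabilizer D^Z_i: Z-part the indicator of {i,…,m−1} × {0}. -/
def DZ {m n : ℕ} (i : Fin (m - 1)) : V m n :=
  (0, fun q => if i.val + 1 ≤ q.1.val ∧ q.2.val = 0 then 1 else 0)


/-- Indicators of the pairs of vertically adjacent cells of a `k × ι` grid are linearly
independent. -/
theorem linearIndependent_adjacentIndicator (R : Type*) [CommRing R] (k : ℕ) (ι : Type*)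
    [Fintype ι] [DecidableEq ι] :
    LinearIndependent R (fun (p : Fin (k - 1) × ι) (q : Fin k × ι) =>
      if (q.1.val = p.1.val ∨ q.1.val = p.1.val + 1) ∧ q.2 = p.2 then (1 : R) else 0) := by
  rw [Fintype.linearIndependent_iff]
  intro g hg
  have hrow (i : ℕ) (hi : i < k) (j : ι) :
      (∑ p : Fin (k - 1) × ι, if (i = p.1.val ∨ i = p.1.val + 1) ∧ j = p.2 then g p else 0)
        = 0 := by
    simpa using congrFun hg (⟨i, hi⟩, j)
  have hcoeff (i : ℕ) : ∀ (hi : i < k - 1) (j : ι), g (⟨i, hi⟩, j) = 0 := by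
    induction i with
    | zero =>
      intro hi j
      rw [← hrow 0 (by omega) j, Finset.sum_eq_single (⟨0, hi⟩, j)]
      · simp
      · rintro ⟨a, b⟩ - hne
        rw [if_neg]
        rintro ⟨ha, rfl⟩
        exact hne (Prod.ext (Fin.ext (by simp_all)) rfl)
      · simp
    | succ i ih =>
      intro hi j
      rw [← hrow (i + 1) (by omega) j, Finset.sum_eq_single (⟨i + 1, hi⟩, j)]
      · simp
      · rintro ⟨⟨a, ha⟩, b⟩ - hne
        split_ifs with h
        · obtain ⟨h | h, rfl⟩ := h
          · exact (hne (Prod.ext (Fin.ext h.symm) rfl)).elim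
          · obtain rfl : i = a := by simpa using h
            exact ih ha _
        · rfl
      · simp
  exact fun p => hcoeff p.1 p.1.isLt p.2

theorem linearIndependent_checks (m n : ℕ) :
    LinearIndependent (ZMod 2)
      (Sum.elim (fun p : Fin (m - 1) × Fin n => Hcheck (m := m) (n := n) p.1 p.2)
        (fun p : Fin m × Fin (n - 1) => Wcheck (m := m) (n := n) p.1 p.2)) := by
  have hX := linearIndependent_adjacentIndicator (ZMod 2) m (Fin n)
  have hZ := ((linearIndependent_adjacentIndicator (ZMod 2) n (Fin m)).map'
    (LinearEquiv.funCongrLeft (ZMod 2) (ZMod 2) (Equiv.prodComm (Fin m) (Fin n))).toLinearMap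
    (LinearEquiv.ker _)).comp _ (Equiv.prodComm (Fin m) (Fin (n - 1))).injective
  convert linearIndependent_inl_union_inr' hX hZ using 1
  ext1 (p | p)
  · rfl
  · refine Prod.ext rfl (funext fun q => ?_)
    simp [Wcheck, LinearEquiv.funCongrLeft_apply, LinearMap.funLeft_apply, and_comm]
  · rfl

/-- The m·(n−1) + n·(m−1) Bacon-Shor check vectors are linearly independent over
ZMod 2 in V; consequently the F₂-dimension of their span G equals n·(m−1) + m·(n−1). -/
theorem stmt0 (m n : ℕ) (hm : 2 ≤ m) (hn : 2 ≤ n) :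
    LinearIndependent (ZMod 2)
      (Sum.elim (fun p : Fin (m - 1) × Fin n => Hcheck (m := m) (n := n) p.1 p.2)
        (fun p : Fin m × Fin (n - 1) => Wcheck (m := m) (n := n) p.1 p.2)) ∧
    Module.finrank (ZMod 2) ↥(checkSpan m n) = n * (m - 1) + m * (n - 1) := by
  refine ⟨linearIndependent_checks m n, ?_⟩
  rw [checkSpan, ← Set.Sum.elim_range, finrank_span_eq_card (linearIndependent_checks m n)]
  simp [mul_comm]
end

section
/- The span G of the Bacon-Shor check vectors equals the set of all pairs (a,b) ∈ V such that for every j ∈ Fin n the sum Σ_{i ∈ Fin m} a(i,j) is 0 in ZMod 2, and for every i ∈ Fin m the sum Σ_{j ∈ Fin n} b(i,j) is 0 in ZMod 2. -/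
open Finset

/-- If consecutive vectors of a family are congruent modulo `S`, every linear combination of the
family with coefficient sum zero lies in `S`. -/
lemma sum_smul_mem_of_consecutive_sub_mem {R M : Type*} [Ring R] [AddCommGroup M] [Module R M]
    {S : Submodule R M} {k : ℕ} (e : Fin k → M)
    (he : ∀ i (hi : i + 1 < k), e ⟨i + 1, hi⟩ - e ⟨i, by omega⟩ ∈ S)
    (c : Fin k → R) (hc : ∑ i, c i = 0) : ∑ i, c i • e i ∈ S := by
  rcases Nat.eq_zero_or_pos k with rfl | hk
  · simp
  have key : ∀ i (hi : i < k), e ⟨i, hi⟩ - e ⟨0, hk⟩ ∈ S := by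
    intro i
    induction i with
    | zero => intro hi; simp
    | succ i ih =>
      intro hi
      simpa using S.add_mem (he i hi) (ih (by omega))
  have h : ∑ i, c i • e i = ∑ i, c i • (e i - e ⟨0, hk⟩) := by
    simp [smul_sub, ← Finset.sum_smul, hc]
  rw [h]
  exact S.sum_mem fun i _ => S.smul_mem _ (key i.1 i.2)

lemma Hcheck_eq_sub {m n : ℕ} (i : ℕ) (hi : i + 1 < m) (j : Fin n) :
    (Hcheck ⟨i, by omega⟩ j : V m n) =
      (Pi.single (⟨i + 1, hi⟩, j) 1, 0) - (Pi.single (⟨i, by omega⟩, j) 1, 0) := by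
  refine Prod.ext (funext fun ⟨a, b⟩ => ?_) (by simp [Hcheck])
  simp only [Hcheck, Prod.fst_sub, Pi.sub_apply, CharTwo.sub_eq_add, Pi.single_apply,
    Prod.mk.injEq, Fin.ext_iff]
  split_ifs <;> first | omega | simp

lemma Wcheck_eq_sub {m n : ℕ} (i : Fin m) (j : ℕ) (hj : j + 1 < n) :
    (Wcheck i ⟨j, by omega⟩ : V m n) =
      (0, Pi.single (i, ⟨j + 1, hj⟩) 1) - (0, Pi.single (i, ⟨j, by omega⟩) 1) := by
  refine Prod.ext (by simp [Wcheck]) (funext fun ⟨a, b⟩ => ?_)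
  simp only [Wcheck, Prod.snd_sub, Pi.sub_apply, CharTwo.sub_eq_add, Pi.single_apply,
    Prod.mk.injEq, Fin.ext_iff]
  split_ifs <;> first | omega | simp

lemma Hcheck_mem_checkSpan {m n : ℕ} (i : Fin (m - 1)) (j : Fin n) :
    Hcheck i j ∈ checkSpan m n :=
  Submodule.subset_span (Or.inl ⟨(i, j), rfl⟩)

lemma Wcheck_mem_checkSpan {m n : ℕ} (i : Fin m) (j : Fin (n - 1)) :
    Wcheck i j ∈ checkSpan m n :=
  Submodule.subset_span (Or.inr ⟨(i, j), rfl⟩)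

lemma eq_sum_single_add_sum_single {m n : ℕ} (v : V m n) :
    v = ∑ j, ∑ i, v.1 (i, j) • ((Pi.single (i, j) 1, 0) : V m n) +
      ∑ i, ∑ j, v.2 (i, j) • ((0, Pi.single (i, j) 1) : V m n) := by
  refine Prod.ext (funext fun ⟨a, b⟩ => ?_) (funext fun ⟨a, b⟩ => ?_) <;>
    simp [Prod.fst_sum, Prod.snd_sum, Finset.sum_apply, Pi.single_apply, ite_and]

lemma sum_Hcheck_fst {m n : ℕ} (i : Fin (m - 1)) (j c : Fin n) :
    ∑ a, (Hcheck i j : V m n).1 (a, c) = 0 := by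
  have hi : i.1 + 1 < m := by omega
  rw [show i = ⟨i.1, i.2⟩ from rfl, Hcheck_eq_sub i.1 hi j]
  simp [Pi.single_apply, Finset.sum_sub_distrib, ite_and]

lemma sum_Wcheck_snd {m n : ℕ} (i r : Fin m) (j : Fin (n - 1)) :
    ∑ b, (Wcheck i j : V m n).2 (r, b) = 0 := by
  have hj : j.1 + 1 < n := by omega
  rw [show j = ⟨j.1, j.2⟩ from rfl, Wcheck_eq_sub i j.1 hj]
  simp [Pi.single_apply, Finset.sum_sub_distrib, ite_and]

/-- G equals the set of pairs (a,b) whose X-part has even column sums and whose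
Z-part has even row sums. -/
theorem stmt1 (m n : ℕ) (hm : 2 ≤ m) (hn : 2 ≤ n) :
    (checkSpan m n : Set (V m n)) =
      {v : V m n | (∀ j : Fin n, ∑ i : Fin m, v.1 (i, j) = 0) ∧
                   (∀ i : Fin m, ∑ j : Fin n, v.2 (i, j) = 0)} := by
  ext v
  simp only [SetLike.mem_coe, Set.mem_ofPred_eq]
  constructor
  · intro hv
    induction hv using Submodule.span_induction with
    | mem x hx =>
      rcases hx with ⟨p, rfl⟩ | ⟨p, rfl⟩
      · exact ⟨sum_Hcheck_fst p.1 p.2, fun i => by simp [Hcheck]⟩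
      · exact ⟨fun j => by simp [Wcheck], fun i => sum_Wcheck_snd p.1 i p.2⟩
    | zero => simp
    | add x y _ _ hx hy => simp [Finset.sum_add_distrib, hx, hy]
    | smul c x _ hx => simp [← Finset.mul_sum, hx]
  · rintro ⟨hX, hZ⟩
    rw [eq_sum_single_add_sum_single v]
    refine add_mem (sum_mem fun j _ => ?_) (sum_mem fun i _ => ?_)
    · refine sum_smul_mem_of_consecutive_sub_mem _ (fun i hi => ?_) _ (hX j)
      rw [← Hcheck_eq_sub i hi j]
      exact Hcheck_mem_checkSpan _ _
    · refine sum_smul_mem_of_consecutive_sub_mem _ (fun j hj => ?_) _ (hZ i)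
      rw [← Wcheck_eq_sub i j hj]
      exact Wcheck_mem_checkSpan _ _
end

section
/- The radical of the symplectic form on the check span, namely the subspace {v ∈ G : ∀ w ∈ G, ω(v,w) = 0}, has F₂-dimension (m−1) + (n−1). -/
open Finset

/-- The coordinate-sum functional on `Fin k → ZMod 2`. -/
def coordSum (k : ℕ) : (Fin k → ZMod 2) →ₗ[ZMod 2] ZMod 2 :=
  ∑ i, LinearMap.proj i

lemma coordSum_apply {k : ℕ} (f : Fin k → ZMod 2) : coordSum k f = ∑ i, f i := by
  simp [coordSum]

/-- The lower of the two neighbouring indices joined by `i`. -/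
def lowerIdx {k : ℕ} (i : Fin (k - 1)) : Fin k := ⟨i.val, by omega⟩

/-- The upper of the two neighbouring indices joined by `i`. -/
def upperIdx {k : ℕ} (i : Fin (k - 1)) : Fin k := ⟨i.val + 1, by omega⟩

lemma finrank_ker_coordSum {k : ℕ} (hk : 0 < k) :
    Module.finrank (ZMod 2) (LinearMap.ker (coordSum k)) = k - 1 := by
  have hsurj : LinearMap.range (coordSum k) = ⊤ := by
    rw [LinearMap.range_eq_top]
    intro c
    exact ⟨Pi.single ⟨0, hk⟩ c, by simp [coordSum_apply]⟩
  have h := LinearMap.finrank_range_add_finrank_ker (coordSum k)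
  rw [hsurj, finrank_top, Module.finrank_self, Module.finrank_fin_fun] at h
  omega

/-- Over `ZMod 2`, the sums of two neighbouring unit vectors span the vectors of coordinate
sum zero. -/
lemma ker_coordSum_le_span (k : ℕ) :
    LinearMap.ker (coordSum k) ≤ Submodule.span (ZMod 2)
      (Set.range fun i : Fin (k - 1) =>
        (Pi.single (lowerIdx i) 1 + Pi.single (upperIdx i) 1 : Fin k → ZMod 2)) := by
  intro f hf
  rw [LinearMap.mem_ker, coordSum_apply] at hf
  rcases Nat.eq_zero_or_pos k with rfl | hk
  · rw [Subsingleton.elim f 0]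
    exact zero_mem _
  set S := Submodule.span (ZMod 2) (Set.range fun i : Fin (k - 1) =>
    (Pi.single (lowerIdx i) 1 + Pi.single (upperIdx i) 1 : Fin k → ZMod 2))
  have key : ∀ (a : ℕ) (ha : a < k),
      (Pi.single ⟨0, hk⟩ 1 + Pi.single ⟨a, ha⟩ 1 : Fin k → ZMod 2) ∈ S := by
    intro a
    induction a with
    | zero =>
      intro _
      rw [ZModModule.add_self]
      exact zero_mem _
    | succ a ih =>
      intro ha
      have hstep : (Pi.single ⟨a, by omega⟩ 1 + Pi.single ⟨a + 1, ha⟩ 1 : Fin k → ZMod 2) ∈ S :=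
        Submodule.subset_span ⟨⟨a, by omega⟩, rfl⟩
      have h := S.add_mem (ih (by omega)) hstep
      rwa [← add_assoc, add_assoc (Pi.single _ _), ZModModule.add_self, add_zero] at h
  have hrep : f = ∑ i, f i • (Pi.single ⟨0, hk⟩ 1 + Pi.single i 1 : Fin k → ZMod 2) := by
    simp only [smul_add, Finset.sum_add_distrib, ← Finset.sum_smul, hf, zero_smul, zero_add]
    exact pi_eq_sum_univ' f
  rw [hrep]
  exact S.sum_mem fun i _ => S.smul_mem _ (key i.val i.isLt)

lemma omega_comm {m n : ℕ} (v w : V m n) : omega v w = omega w v :=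
  Finset.sum_congr rfl fun _ _ => add_comm _ _

lemma Hcheck_eq {m n : ℕ} (i : Fin (m - 1)) (j : Fin n) :
    (Hcheck i j : V m n) = (Pi.single (lowerIdx i, j) 1 + Pi.single (upperIdx i, j) 1, 0) := by
  refine Prod.ext (funext fun q => ?_) rfl
  obtain ⟨a, b⟩ := q
  simp only [Hcheck, Pi.add_apply, Pi.single_apply, Prod.mk.injEq, Fin.ext_iff, lowerIdx, upperIdx]
  by_cases hb : b.val = j.val <;> by_cases h₁ : a.val = i.val <;>
    by_cases h₂ : a.val = i.val + 1 <;> first | omega | simp [hb, h₁, h₂]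

lemma Wcheck_eq {m n : ℕ} (i : Fin m) (j : Fin (n - 1)) :
    (Wcheck i j : V m n) = (0, Pi.single (i, lowerIdx j) 1 + Pi.single (i, upperIdx j) 1) := by
  refine Prod.ext rfl (funext fun q => ?_)
  obtain ⟨a, b⟩ := q
  simp only [Wcheck, Pi.add_apply, Pi.single_apply, Prod.mk.injEq, Fin.ext_iff, lowerIdx, upperIdx]
  by_cases hb : a.val = i.val <;> by_cases h₁ : b.val = j.val <;>
    by_cases h₂ : b.val = j.val + 1 <;> first | omega | simp [hb, h₁, h₂]

lemma omega_Hcheck {m n : ℕ} (v : V m n) (i : Fin (m - 1)) (j : Fin n) :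
    omega v (Hcheck i j) = v.2 (lowerIdx i, j) + v.2 (upperIdx i, j) := by
  simp [omega, Hcheck_eq, add_mul, Finset.sum_add_distrib, Pi.single_apply]

lemma omega_Wcheck {m n : ℕ} (v : V m n) (i : Fin m) (j : Fin (n - 1)) :
    omega v (Wcheck i j) = v.1 (i, lowerIdx j) + v.1 (i, upperIdx j) := by
  simp [omega, Wcheck_eq, mul_add, Finset.sum_add_distrib, Pi.single_apply]

lemma checkSpan_le {m n : ℕ} {S : Submodule (ZMod 2) (V m n)}
    (hH : ∀ i j, Hcheck i j ∈ S) (hW : ∀ i j, Wcheck i j ∈ S) : checkSpan m n ≤ S := by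
  refine Submodule.span_le.2 ?_
  rintro _ (⟨p, rfl⟩ | ⟨p, rfl⟩)
  exacts [hH _ _, hW _ _]

lemma mem_radical {m n : ℕ} {v : V m n} :
    v ∈ radical m n ↔ v ∈ checkSpan m n ∧
      (∀ i j, omega v (Hcheck i j) = 0) ∧ ∀ i j, omega v (Wcheck i j) = 0 := by
  simp only [radical, Submodule.mem_inf, Submodule.mem_iInf]
  refine and_congr_right fun _ => ⟨fun h => ⟨fun i j => h _ (Hcheck_mem_checkSpan i j),
    fun i j => h _ (Wcheck_mem_checkSpan i j)⟩, fun h w hw => ?_⟩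
  have hle : checkSpan m n ≤ LinearMap.ker (omegaR v) :=
    checkSpan_le (fun i j => (omega_comm _ _).trans (h.1 i j))
      (fun i j => (omega_comm _ _).trans (h.2 i j))
  exact (omega_comm _ _).trans (hle hw)

lemma sum_fst_of_mem_checkSpan {m n : ℕ} {v : V m n} (hv : v ∈ checkSpan m n) (j : Fin n) :
    ∑ i, v.1 (i, j) = 0 := by
  let T : V m n →ₗ[ZMod 2] ZMod 2 :=
    coordSum m ∘ₗ LinearMap.funLeft (ZMod 2) (ZMod 2) (fun i => (i, j)) ∘ₗ LinearMap.fst _ _ _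
  have hT : ∀ w, T w = ∑ i, w.1 (i, j) := fun w => coordSum_apply _
  have hle : checkSpan m n ≤ LinearMap.ker T := by
    refine checkSpan_le (fun a b => ?_) (fun a b => ?_)
    · rw [LinearMap.mem_ker, hT, Hcheck_eq]
      by_cases hb : j = b <;>
        simp [Pi.single_apply, hb, Finset.sum_add_distrib, CharTwo.add_self_eq_zero]
    · rw [LinearMap.mem_ker, hT, Wcheck_eq]
      simp
  rw [← hT]
  exact hle hv

lemma sum_snd_of_mem_checkSpan {m n : ℕ} {v : V m n} (hv : v ∈ checkSpan m n) (i : Fin m) :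
    ∑ j, v.2 (i, j) = 0 := by
  let T : V m n →ₗ[ZMod 2] ZMod 2 :=
    coordSum n ∘ₗ LinearMap.funLeft (ZMod 2) (ZMod 2) (fun j => (i, j)) ∘ₗ LinearMap.snd _ _ _
  have hT : ∀ w, T w = ∑ j, w.2 (i, j) := fun w => coordSum_apply _
  have hle : checkSpan m n ≤ LinearMap.ker T := by
    refine checkSpan_le (fun a b => ?_) (fun a b => ?_)
    · rw [LinearMap.mem_ker, hT, Hcheck_eq]
      simp
    · rw [LinearMap.mem_ker, hT, Wcheck_eq]
      by_cases hb : i = a <;>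
        simp [Pi.single_apply, hb, Finset.sum_add_distrib, CharTwo.add_self_eq_zero]
  rw [← hT]
  exact hle hv

/-- The operators whose X-support depends only on the first grid coordinate and whose Z-support
depends only on the second. -/
def stripeMap (m n : ℕ) : (Fin m → ZMod 2) × (Fin n → ZMod 2) →ₗ[ZMod 2] V m n :=
  (LinearMap.funLeft (ZMod 2) (ZMod 2) Prod.fst).prodMap
    (LinearMap.funLeft (ZMod 2) (ZMod 2) Prod.snd)

lemma stripeMap_injective {m n : ℕ} (hm : 0 < m) (hn : 0 < n) :
    Function.Injective (stripeMap m n) := by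
  have : NeZero m := ⟨hm.ne'⟩
  have : NeZero n := ⟨hn.ne'⟩
  exact Function.Injective.prodMap
    (LinearMap.funLeft_injective_of_surjective (ZMod 2) (ZMod 2) _ Prod.fst_surjective)
    (LinearMap.funLeft_injective_of_surjective (ZMod 2) (ZMod 2) _ Prod.snd_surjective)

lemma stripeMap_fst_mem_checkSpan {m n : ℕ} {f : Fin m → ZMod 2}
    (hf : f ∈ LinearMap.ker (coordSum m)) : stripeMap m n (f, 0) ∈ checkSpan m n := by
  have hle : Submodule.span (ZMod 2) (Set.range fun i : Fin (m - 1) =>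
      (Pi.single (lowerIdx i) 1 + Pi.single (upperIdx i) 1 : Fin m → ZMod 2)) ≤
      (checkSpan m n).comap (stripeMap m n ∘ₗ LinearMap.inl _ _ _) := by
    refine Submodule.span_le.2 ?_
    rintro _ ⟨i, rfl⟩
    have h : stripeMap m n (Pi.single (lowerIdx i) 1 + Pi.single (upperIdx i) 1, 0) =
        ∑ j, Hcheck i j := by
      simp only [Hcheck_eq]
      refine Prod.ext (funext fun q => ?_) (funext fun q => ?_)
      · obtain ⟨a, b⟩ := q
        simp [stripeMap, LinearMap.funLeft_apply, Prod.fst_sum, Finset.sum_apply,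
          Pi.single_apply, Finset.sum_add_distrib, ite_and]
      · simp [stripeMap, Prod.snd_sum]
    change stripeMap m n (Pi.single (lowerIdx i) 1 + Pi.single (upperIdx i) 1, 0) ∈ checkSpan m n
    rw [h]
    exact Submodule.sum_mem _ fun j _ => Hcheck_mem_checkSpan i j
  exact hle (ker_coordSum_le_span m hf)

lemma stripeMap_snd_mem_checkSpan {m n : ℕ} {g : Fin n → ZMod 2}
    (hg : g ∈ LinearMap.ker (coordSum n)) : stripeMap m n (0, g) ∈ checkSpan m n := by
  have hle : Submodule.span (ZMod 2) (Set.range fun j : Fin (n - 1) =>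
      (Pi.single (lowerIdx j) 1 + Pi.single (upperIdx j) 1 : Fin n → ZMod 2)) ≤
      (checkSpan m n).comap (stripeMap m n ∘ₗ LinearMap.inr _ _ _) := by
    refine Submodule.span_le.2 ?_
    rintro _ ⟨j, rfl⟩
    have h : stripeMap m n (0, Pi.single (lowerIdx j) 1 + Pi.single (upperIdx j) 1) =
        ∑ i, Wcheck i j := by
      simp only [Wcheck_eq]
      refine Prod.ext (funext fun q => ?_) (funext fun q => ?_)
      · simp [stripeMap, Prod.fst_sum]
      · obtain ⟨a, b⟩ := q
        simp [stripeMap, LinearMap.funLeft_apply, Prod.snd_sum, Finset.sum_apply,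
          Pi.single_apply, Finset.sum_add_distrib, ite_and]
    change stripeMap m n (0, Pi.single (lowerIdx j) 1 + Pi.single (upperIdx j) 1) ∈ checkSpan m n
    rw [h]
    exact Submodule.sum_mem _ fun i _ => Wcheck_mem_checkSpan i j
  exact hle (ker_coordSum_le_span n hg)

lemma eq_of_lowerIdx_eq_upperIdx {k : ℕ} {α : Type*} {f : Fin k → α}
    (h : ∀ i : Fin (k - 1), f (lowerIdx i) = f (upperIdx i)) (a b : Fin k) : f a = f b := by
  have key : ∀ (c : ℕ) (hc : c < k), f ⟨c, hc⟩ = f ⟨0, by omega⟩ := by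
    intro c
    induction c with
    | zero => intro _; rfl
    | succ c ih => exact fun hc => (h ⟨c, by omega⟩).symm.trans (ih (by omega))
  exact (key a.val a.isLt).trans (key b.val b.isLt).symm

lemma radical_eq_range {m n : ℕ} (hm : 0 < m) (hn : 0 < n) :
    radical m n = LinearMap.range (stripeMap m n ∘ₗ
      (LinearMap.ker (coordSum m)).subtype.prodMap (LinearMap.ker (coordSum n)).subtype) := by
  ext v
  rw [mem_radical, LinearMap.mem_range]
  constructor
  · rintro ⟨hv, hH, hW⟩
    refine ⟨(⟨fun i => v.1 (i, ⟨0, hn⟩),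
        (coordSum_apply _).trans (sum_fst_of_mem_checkSpan hv _)⟩,
      ⟨fun j => v.2 (⟨0, hm⟩, j),
        (coordSum_apply _).trans (sum_snd_of_mem_checkSpan hv _)⟩), ?_⟩
    refine Prod.ext (funext fun q => ?_) (funext fun q => ?_)
    · exact eq_of_lowerIdx_eq_upperIdx (f := fun j => v.1 (q.1, j))
        (fun j => CharTwo.add_eq_zero.1 ((omega_Wcheck v q.1 j).symm.trans (hW q.1 j))) _ _
    · exact eq_of_lowerIdx_eq_upperIdx (f := fun i => v.2 (i, q.2))
        (fun i => CharTwo.add_eq_zero.1 ((omega_Hcheck v i q.2).symm.trans (hH i q.2))) _ _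
  · rintro ⟨⟨⟨f, hf⟩, ⟨g, hg⟩⟩, rfl⟩
    refine ⟨?_, fun i j => ?_, fun i j => ?_⟩
    · have h := Submodule.add_mem _ (stripeMap_fst_mem_checkSpan (n := n) hf)
        (stripeMap_snd_mem_checkSpan (m := m) hg)
      rwa [← map_add, Prod.mk_add_mk, add_zero, zero_add] at h
    · rw [omega_Hcheck]
      exact CharTwo.add_self_eq_zero (g j)
    · rw [omega_Wcheck]
      exact CharTwo.add_self_eq_zero (f i)

/-- The radical of the symplectic form on the check span has F₂-dimension (m−1)+(n−1). -/
theorem stmt2 (m n : ℕ) (hm : 2 ≤ m) (hn : 2 ≤ n) :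
    Module.finrank (ZMod 2) ↥(radical m n) = (m - 1) + (n - 1) := by
  have hm' : 0 < m := by omega
  have hn' : 0 < n := by omega
  rw [radical_eq_range hm' hn', LinearMap.finrank_range_of_inj, Module.finrank_prod,
    finrank_ker_coordSum hm', finrank_ker_coordSum hn']
  exact (stripeMap_injective hm' hn').comp
    (Function.Injective.prodMap (Submodule.subtype_injective _) (Submodule.subtype_injective _))
end

section
/- For all 1 ≤ a, c ≤ m−1 and 1 ≤ b, d ≤ n−1, the gauge-qubit vectors satisfy ω(X̄_{a,b}, Z̄_{c,d}) = 1 in ZMod 2 if (a,b) = (c,d) and ω(X̄_{a,b}, Z̄_{c,d}) = 0 otherwise; moreover every X̄_{a,b} and every Z̄_{c,d} lies in the check span G (indeed X̄_{a,b} = Σ_{j=b}^{n−1} H(a−1,j) and Z̄_{c,d} = Σ_{i=c}^{m−1} W(i,d−1)). -/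
open Finset

/-- The intervals `{a, a + 1}` and `{c + 1, …, m - 1}` overlap in an odd number of points
exactly when `a = c`. -/
lemma sum_pair_mul_tail {m : ℕ} (a c : Fin (m - 1)) :
    ∑ i : Fin m, (if i.val = a.val ∨ i.val = a.val + 1 then (1 : ZMod 2) else 0) *
      (if c.val + 1 ≤ i.val then 1 else 0) = if a = c then 1 else 0 := by
  have split_pair (i : Fin m) : (if i.val = a.val ∨ i.val = a.val + 1 then (1 : ZMod 2) else 0) =
      (if i = ⟨a.val, by omega⟩ then 1 else 0) + (if i = ⟨a.val + 1, by omega⟩ then 1 else 0) := by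
    simp only [Fin.ext_iff]
    split_ifs <;> first | omega | simp
  simp only [split_pair, add_mul, Finset.sum_add_distrib, ite_mul, one_mul, zero_mul,
    Finset.sum_ite_eq', Finset.mem_univ, if_true]
  simp only [Fin.ext_iff]
  split_ifs <;> first | omega | decide

lemma omega_gaugeX_gaugeZ {m n : ℕ} (a c : Fin (m - 1)) (b d : Fin (n - 1)) :
    omega (gaugeX (m := m) (n := n) a b) (gaugeZ c d) = if a = c ∧ b = d then 1 else 0 := by
  calc omega (gaugeX (m := m) (n := n) a b) (gaugeZ c d)
      = (∑ i : Fin m, (if i.val = a.val ∨ i.val = a.val + 1 then (1 : ZMod 2) else 0) *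
          (if c.val + 1 ≤ i.val then 1 else 0)) *
        ∑ j : Fin n, (if j.val = d.val ∨ j.val = d.val + 1 then (1 : ZMod 2) else 0) *
          (if b.val + 1 ≤ j.val then 1 else 0) := by
        rw [Finset.sum_mul_sum, ← Finset.sum_product', Finset.univ_product_univ]
        refine Finset.sum_congr rfl fun q _ => ?_
        simp only [gaugeX, gaugeZ, Pi.zero_apply, mul_zero, add_zero, ite_and]
        split_ifs <;> simp
    _ = if a = c ∧ b = d then 1 else 0 := by
        rw [sum_pair_mul_tail, sum_pair_mul_tail, ite_and]
        simp only [eq_comm (a := d), ite_mul, one_mul, zero_mul]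

lemma gaugeX_eq_sum_Hcheck {m n : ℕ} (a : Fin (m - 1)) (b : Fin (n - 1)) :
    gaugeX (m := m) (n := n) a b =
      ∑ j ∈ Finset.univ.filter (fun j : Fin n => b.val + 1 ≤ j.val), Hcheck a j := by
  refine Prod.ext (funext fun q => ?_) ?_
  · simp [gaugeX, Hcheck, Prod.fst_sum, Finset.sum_apply, ite_and, Finset.sum_ite_irrel]
  · simp [gaugeX, Hcheck, Prod.snd_sum]

lemma gaugeZ_eq_sum_Wcheck {m n : ℕ} (c : Fin (m - 1)) (d : Fin (n - 1)) :
    gaugeZ (m := m) (n := n) c d =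
      ∑ i ∈ Finset.univ.filter (fun i : Fin m => c.val + 1 ≤ i.val), Wcheck i d := by
  refine Prod.ext ?_ (funext fun q => ?_)
  · simp [gaugeZ, Wcheck, Prod.fst_sum]
  · simp [gaugeZ, Wcheck, Prod.snd_sum, Finset.sum_apply, ite_and]

/-- The gauge-qubit vectors form symplectic pairs: ω(X̄_{a,b}, Z̄_{c,d}) = 1 iff
(a,b) = (c,d) and 0 otherwise; moreover every X̄_{a,b} and Z̄_{c,d} lies in G,
being explicit sums of checks. -/
theorem stmt8 (m n : ℕ) (hm : 2 ≤ m) (hn : 2 ≤ n) :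
    (∀ (a c : Fin (m - 1)) (b d : Fin (n - 1)),
      omega (gaugeX a b) (gaugeZ c d) = if a = c ∧ b = d then 1 else 0) ∧
    (∀ (a : Fin (m - 1)) (b : Fin (n - 1)), gaugeX (m := m) (n := n) a b ∈ checkSpan m n) ∧
    (∀ (c : Fin (m - 1)) (d : Fin (n - 1)), gaugeZ (m := m) (n := n) c d ∈ checkSpan m n) ∧
    (∀ (a : Fin (m - 1)) (b : Fin (n - 1)),
      gaugeX (m := m) (n := n) a b =
        ∑ j ∈ Finset.univ.filter (fun j : Fin n => b.val + 1 ≤ j.val), Hcheck a j) ∧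
    (∀ (c : Fin (m - 1)) (d : Fin (n - 1)),
      gaugeZ (m := m) (n := n) c d =
        ∑ i ∈ Finset.univ.filter (fun i : Fin m => c.val + 1 ≤ i.val), Wcheck i d) := by
  refine ⟨omega_gaugeX_gaugeZ, fun a b => ?_, fun c d => ?_, gaugeX_eq_sum_Hcheck,
    gaugeZ_eq_sum_Wcheck⟩
  · rw [gaugeX_eq_sum_Hcheck]
    exact Submodule.sum_mem _ fun j _ => Hcheck_mem_checkSpan a j
  · rw [gaugeZ_eq_sum_Wcheck]
    exact Submodule.sum_mem _ fun i _ => Wcheck_mem_checkSpan i d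
end

section
/- Every gauge-qubit vector symplectically commutes with every stabilizer vector and with both logical vectors: for all 1 ≤ a ≤ m−1, 1 ≤ b ≤ n−1, 1 ≤ i ≤ m−1, 1 ≤ j ≤ n−1, one has ω(X̄_{a,b}, S^X_i) = ω(X̄_{a,b}, S^Z_j) = ω(X̄_{a,b}, Z̄_L) = ω(X̄_{a,b}, X̄_L) = 0 and ω(Z̄_{a,b}, S^X_i) = ω(Z̄_{a,b}, S^Z_j) = ω(Z̄_{a,b}, X̄_L) = ω(Z̄_{a,b}, Z̄_L) = 0. -/
open Finset

theorem sum_adjacent_indicator {k : ℕ} (a : Fin (k - 1)) :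
    ∑ x : Fin k, (if x.val = a.val ∨ x.val = a.val + 1 then (1 : ZMod 2) else 0) = 0 := by
  have ha := a.isLt
  have hfilter : (univ.filter fun x : Fin k => x.val = a.val ∨ x.val = a.val + 1) =
      {⟨a.val, by omega⟩, ⟨a.val + 1, by omega⟩} := by
    ext x
    simp [Fin.ext_iff]
  rw [← sum_filter, hfilter, sum_pair (by simp [Fin.ext_iff])]
  exact CharTwo.add_self_eq_zero 1

theorem sum_adjacent_rows_mul {m n : ℕ} (a : Fin (m - 1)) (g : Fin n → ZMod 2) :
    ∑ q : Fin m × Fin n,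
      (if q.1.val = a.val ∨ q.1.val = a.val + 1 then (1 : ZMod 2) else 0) * g q.2 = 0 := by
  simp only [Fintype.sum_prod_type_right, ← sum_mul, sum_adjacent_indicator, zero_mul,
    sum_const_zero]

theorem sum_mul_adjacent_columns {m n : ℕ} (b : Fin (n - 1)) (f : Fin m → ZMod 2) :
    ∑ q : Fin m × Fin n,
      f q.1 * (if q.2.val = b.val ∨ q.2.val = b.val + 1 then (1 : ZMod 2) else 0) = 0 := by
  simp only [Fintype.sum_prod_type, ← mul_sum, sum_adjacent_indicator, mul_zero, sum_const_zero]

/-- A gauge `X` operator commutes with every operator whose `Z`-support is a union of columns. -/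
theorem omega_gaugeX_of_columns {m n : ℕ} (a : Fin (m - 1)) (b : Fin (n - 1))
    (u : Fin m × Fin n → ZMod 2) (g : Fin n → ZMod 2) :
    omega (gaugeX a b) (u, fun q => g q.2) = 0 := by
  rw [← sum_adjacent_rows_mul a fun y => (if b.val + 1 ≤ y.val then 1 else 0) * g y]
  refine sum_congr rfl fun q _ => ?_
  simp only [gaugeX, ite_and, Pi.zero_apply]
  split_ifs <;> simp

/-- A gauge `Z` operator commutes with every operator whose `X`-support is a union of rows. -/
theorem omega_gaugeZ_of_rows {m n : ℕ} (a : Fin (m - 1)) (b : Fin (n - 1)) (f : Fin m → ZMod 2)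
    (u : Fin m × Fin n → ZMod 2) : omega (gaugeZ a b) (fun q => f q.1, u) = 0 := by
  rw [← sum_mul_adjacent_columns b fun x => f x * (if a.val + 1 ≤ x.val then 1 else 0)]
  refine sum_congr rfl fun q _ => ?_
  simp only [gaugeZ, ite_and, Pi.zero_apply]
  split_ifs <;> simp

/-- Every gauge-qubit vector symplectically commutes with every stabilizer vector
and with both logical vectors. -/
theorem stmt9 (m n : ℕ) (hm : 2 ≤ m) (hn : 2 ≤ n) :
    ∀ (a i : Fin (m - 1)) (b j : Fin (n - 1)),
      omega (gaugeX a b) (SX (m := m) (n := n) i) = 0 ∧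
      omega (gaugeX a b) (SZ (m := m) (n := n) j) = 0 ∧
      omega (gaugeX a b) (ZL (m := m) (n := n)) = 0 ∧
      omega (gaugeX a b) (XL (m := m) (n := n)) = 0 ∧
      omega (gaugeZ a b) (SX (m := m) (n := n) i) = 0 ∧
      omega (gaugeZ a b) (SZ (m := m) (n := n) j) = 0 ∧
      omega (gaugeZ a b) (XL (m := m) (n := n)) = 0 ∧
      omega (gaugeZ a b) (ZL (m := m) (n := n)) = 0 := by
  intro a i b j
  exact ⟨omega_gaugeX_of_columns a b _ fun _ => 0,
    omega_gaugeX_of_columns a b _ fun y => if y.val = j.val ∨ y.val = j.val + 1 then 1 else 0,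
    omega_gaugeX_of_columns a b _ fun y => if y.val = 0 then 1 else 0,
    omega_gaugeX_of_columns a b _ fun _ => 0,
    omega_gaugeZ_of_rows a b (fun x => if x.val = i.val ∨ x.val = i.val + 1 then 1 else 0) _,
    omega_gaugeZ_of_rows a b (fun _ => 0) _,
    omega_gaugeZ_of_rows a b (fun x => if x.val = 0 then 1 else 0) _,
    omega_gaugeZ_of_rows a b (fun _ => 0) _⟩
end

section
/- For all 1 ≤ i, k ≤ m−1 and all 1 ≤ a ≤ m−1, 1 ≤ b ≤ n−1, the vertical destabilizer vectors satisfy: ω(S^X_k, D^Z_i) = 1 in ZMod 2 if i = k and 0 otherwise; ω(X̄_{a,b}, D^Z_i) = 0; and ω(X̄_L, D^Z_i) = 0. (Thus D^Z_i is the canonical symplectic partner of the vertical stabilizer S^X_i.) -/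
open Finset

/-- `DZ i` is supported on column 0, so only that column contributes to the pairing. -/
theorem omega_DZ {m n : ℕ} (hn : 0 < n) (v : V m n) (hv : v.2 = 0) (i : Fin (m - 1)) :
    omega v (DZ i) = ∑ r : Fin m, if i.val + 1 ≤ r.val then v.1 (r, ⟨0, hn⟩) else 0 := by
  simp only [omega, DZ, Fintype.sum_prod_type, hv]
  refine Finset.sum_congr rfl fun r _ => ?_
  rw [Finset.sum_eq_single_of_mem ⟨0, hn⟩ (Finset.mem_univ _)]
  · simp
  · intro c _ hc
    have : c.val ≠ 0 := fun h => hc (Fin.ext h)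
    simp [this]

/-- Two adjacent rows meet the rows below `i` in an odd number exactly when they straddle `i`. -/
theorem sum_adjacent_rows {m : ℕ} (i k : Fin (m - 1)) :
    (∑ r : Fin m, if i.val + 1 ≤ r.val then
      (if r.val = k.val ∨ r.val = k.val + 1 then (1 : ZMod 2) else 0) else 0) =
      if i = k then 1 else 0 := by
  have hk : k.val < m ∧ k.val + 1 < m := by omega
  rw [← Finset.sum_subset
    (Finset.subset_univ {(⟨k.val, hk.1⟩ : Fin m), ⟨k.val + 1, hk.2⟩})]
  · rw [Finset.sum_pair (by simp)]
    rcases lt_trichotomy i.val k.val with h | h | h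
    · have hne : i ≠ k := fun e => by simp [e] at h
      rw [if_pos (Nat.succ_le_of_lt h), if_pos (Nat.succ_le_succ h.le), if_neg hne,
        if_pos (Or.inl rfl), if_pos (Or.inr rfl), CharTwo.add_self_eq_zero]
    · obtain rfl : i = k := Fin.ext h
      simp
    · have hne : i ≠ k := fun e => by simp [e] at h
      rw [if_neg (by dsimp only; omega), if_neg (by dsimp only; omega), if_neg hne, add_zero]
  · intro r _ hr
    simp only [Finset.mem_insert, Finset.mem_singleton, Fin.ext_iff] at hr
    simp [hr]

/-- D^Z_i is the canonical symplectic partner of the vertical stabilizer S^X_i: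
ω(S^X_k, D^Z_i) = δ_{ik}, and D^Z_i commutes with every X̄_{a,b} and with X̄_L. -/
theorem stmt11 (m n : ℕ) (hm : 2 ≤ m) (hn : 2 ≤ n) :
    (∀ i k : Fin (m - 1),
      omega (SX (m := m) (n := n) k) (DZ (m := m) (n := n) i) = if i = k then 1 else 0) ∧
    (∀ (i a : Fin (m - 1)) (b : Fin (n - 1)),
      omega (gaugeX a b) (DZ (m := m) (n := n) i) = 0) ∧
    (∀ i : Fin (m - 1), omega (XL (m := m) (n := n)) (DZ (m := m) (n := n) i) = 0) := by
  have hn0 : 0 < n := by omega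
  refine ⟨fun i k => ?_, fun i a b => ?_, fun i => ?_⟩
  · rw [omega_DZ hn0 _ rfl]
    exact sum_adjacent_rows i k
  · rw [omega_DZ hn0 _ rfl]
    simp [gaugeX]
  · rw [omega_DZ hn0 _ rfl]
    refine Finset.sum_eq_zero fun r _ => ?_
    simp only [XL]
    split_ifs <;> first | rfl | omega
end

section
/- The 2·m·n vectors consisting of: the gauge pairs X̄_{a,b}, Z̄_{a,b} for 1 ≤ a ≤ m−1 and 1 ≤ b ≤ n−1; the stabilizer–destabilizer pairs S^X_i, D^Z_i for 1 ≤ i ≤ m−1 and S^Z_j, D^X_j for 1 ≤ j ≤ n−1; and the logical pair X̄_L, Z̄_L, together form a basis of the F₂-vector space V. (This is the canonical virtual-qubit decomposition of the n-qubit Pauli group for the Bacon-Shor code.) -/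
open Finset

/-- The canonical virtual-qubit family for the Bacon-Shor code: gauge pairs,
stabilizer–destabilizer pairs and the logical pair. -/
def virtualFamily (m n : ℕ) :
    ((Fin (m - 1) × Fin (n - 1)) ⊕ (Fin (m - 1) × Fin (n - 1))) ⊕
      ((Fin (m - 1) ⊕ Fin (m - 1)) ⊕ (Fin (n - 1) ⊕ Fin (n - 1))) ⊕ Bool → V m n :=
  Sum.elim
    (Sum.elim (fun p => gaugeX p.1 p.2) (fun p => gaugeZ p.1 p.2))
    (Sum.elim
      (Sum.elim (Sum.elim SX DZ) (Sum.elim SZ DX))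
      (fun b : Bool => if b then XL else ZL))

/-- A subspace of functions on a grid that contains the indicators of `{0} × {j,…}` and of
`{i,i+1} × {j,…}` is everything. -/
theorem eq_top_of_staircase_mem {m n : ℕ} (P : Submodule (ZMod 2) (Fin m × Fin n → ZMod 2))
    (h_zero : ∀ j < n, (fun q => if q.1.val = 0 ∧ j ≤ q.2.val then 1 else 0) ∈ P)
    (h_succ : ∀ i j, i + 1 < m → j < n →
      (fun q => if (q.1.val = i ∨ q.1.val = i + 1) ∧ j ≤ q.2.val then 1 else 0) ∈ P) :
    P = ⊤ := by
  have h_row : ∀ i j, i < m → j < n →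
      (fun q => if q.1.val = i ∧ j ≤ q.2.val then 1 else 0) ∈ P := by
    intro i j hi hj
    induction i with
    | zero => exact h_zero j hj
    | succ i ih =>
      convert P.sub_mem (h_succ i j hi hj) (ih (by omega)) using 1
      ext q
      simp only [Pi.sub_apply]
      split_ifs <;> first | omega | simp
  have h_single : ∀ p, Pi.single p 1 ∈ P := by
    rintro ⟨i, j⟩
    by_cases hj : j.val + 1 < n
    · convert P.sub_mem (h_row i j i.2 j.2) (h_row i (j + 1) i.2 hj) using 1
      ext q
      simp only [Pi.sub_apply, Pi.single_apply, Prod.ext_iff, Fin.ext_iff]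
      split_ifs <;> first | omega | simp
    · convert h_row i j i.2 j.2 using 1
      ext q
      simp only [Pi.single_apply, Prod.ext_iff, Fin.ext_iff]
      split_ifs <;> first | omega | rfl
  refine eq_top_iff.2 fun f _ => ?_
  rw [← Finset.univ_sum_single f]
  refine P.sum_mem fun p _ => ?_
  simpa [← Pi.single_smul] using P.smul_mem (f p) (h_single p)

theorem span_virtualFamily (m n : ℕ) :
    Submodule.span (ZMod 2) (Set.range (virtualFamily m n)) = ⊤ := by
  set S := Submodule.span (ZMod 2) (Set.range (virtualFamily m n))
  have h_mem : ∀ k, virtualFamily m n k ∈ S := fun k => Submodule.subset_span ⟨k, rfl⟩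
  have hX : S.comap (LinearMap.inl (ZMod 2) _ _) = ⊤ := by
    apply eq_top_of_staircase_mem
    · rintro (_ | j) hj
      · rw [Submodule.mem_comap]
        convert h_mem (.inr (.inr true)) using 1
        simp [virtualFamily, XL]
      · exact h_mem (.inr (.inl (.inr (.inr ⟨j, by omega⟩))))
    · rintro i (_ | j) hi hj
      · rw [Submodule.mem_comap]
        convert h_mem (.inr (.inl (.inl (.inl ⟨i, by omega⟩)))) using 1
        simp [virtualFamily, SX]
      · exact h_mem (.inl (.inl (⟨i, by omega⟩, ⟨j, by omega⟩)))
  have hZ : S.comap (LinearMap.inr (ZMod 2) (Fin m × Fin n → ZMod 2) _ ∘ₗ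
      LinearMap.funLeft (ZMod 2) (ZMod 2) (Prod.swap : Fin m × Fin n → Fin n × Fin m)) = ⊤ := by
    apply eq_top_of_staircase_mem
    · rintro (_ | i) hi
      · rw [Submodule.mem_comap]
        convert h_mem (.inr (.inr false)) using 1
        ext q <;> simp [virtualFamily, ZL, LinearMap.funLeft_apply]
      · rw [Submodule.mem_comap]
        convert h_mem (.inr (.inl (.inl (.inr ⟨i, by omega⟩)))) using 1
        ext q <;> simp [virtualFamily, DZ, LinearMap.funLeft_apply, and_comm]
    · rintro j (_ | i) hj hi
      · rw [Submodule.mem_comap]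
        convert h_mem (.inr (.inl (.inr (.inl ⟨j, by omega⟩)))) using 1
        ext q <;> simp [virtualFamily, SZ, LinearMap.funLeft_apply]
      · rw [Submodule.mem_comap]
        convert h_mem (.inl (.inr (⟨i, by omega⟩, ⟨j, by omega⟩))) using 1
        ext q <;> simp [virtualFamily, gaugeZ, LinearMap.funLeft_apply, and_comm]
  refine eq_top_iff.2 fun v _ => ?_
  have h_fst : (v.1, 0) ∈ S :=
    Submodule.mem_comap.1 (hX.ge (Submodule.mem_top (x := v.1)))
  have h_snd : (0, v.2) ∈ S :=
    Submodule.mem_comap.1 (hZ.ge (Submodule.mem_top (x := v.2 ∘ Prod.swap)))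
  simpa using S.add_mem h_fst h_snd

/-- The 2·m·n vectors consisting of the gauge pairs X̄_{a,b}, Z̄_{a,b}, the
stabilizer–destabilizer pairs S^X_i, D^Z_i and S^Z_j, D^X_j, and the logical pair
X̄_L, Z̄_L form a basis of V: they are linearly independent and span V. -/
theorem stmt12 (m n : ℕ) (hm : 2 ≤ m) (hn : 2 ≤ n) :
    LinearIndependent (ZMod 2) (virtualFamily m n) ∧
    Submodule.span (ZMod 2) (Set.range (virtualFamily m n)) = ⊤ := by
  have h_span := span_virtualFamily m n
  refine ⟨linearIndependent_of_top_le_span_of_card_eq_finrank h_span.ge ?_, h_span⟩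
  obtain ⟨m, rfl⟩ := Nat.exists_eq_add_of_le' (one_le_two.trans hm)
  obtain ⟨n, rfl⟩ := Nat.exists_eq_add_of_le' (one_le_two.trans hn)
  simp only [Fintype.card_sum, Fintype.card_prod, Fintype.card_fin, Fintype.card_bool,
    Module.finrank_prod, Module.finrank_fintype_fun_eq_card, Nat.add_sub_cancel]
  ring
end

section
/- There exists a period-4 solution of the coloring game on the 4×4 board. -/
/-- A coloring of the b×b board: `true` = red, `false` = blue. -/
def Coloring (b : ℕ) := Fin b × Fin b → Bool

/-- A vertical strip {x} × {y : y₁ ≤ y ≤ y₂}. -/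
def IsVStrip {b : ℕ} (S : Set (Fin b × Fin b)) : Prop :=
  ∃ x y₁ y₂ : Fin b, S = {p : Fin b × Fin b | p.1 = x ∧ y₁ ≤ p.2 ∧ p.2 ≤ y₂}

/-- A horizontal strip {x : x₁ ≤ x ≤ x₂} × {y}. -/
def IsHStrip {b : ℕ} (S : Set (Fin b × Fin b)) : Prop :=
  ∃ y x₁ x₂ : Fin b, S = {p : Fin b × Fin b | p.2 = y ∧ x₁ ≤ p.1 ∧ p.1 ≤ x₂}

/-- `Follows C C'` : coloring C' follows coloring C. For every box p whose color
changed: if p is now red, p lies in a vertical strip that is entirely red in C'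
and that contains a box that was already red in C; symmetrically for blue with a
horizontal strip. -/
def Follows {b : ℕ} (C C' : Coloring b) : Prop :=
  ∀ p : Fin b × Fin b, C' p ≠ C p →
    (C' p = true →
      ∃ S : Set (Fin b × Fin b), IsVStrip S ∧ p ∈ S ∧
        (∀ q ∈ S, C' q = true) ∧ ∃ q₀ ∈ S, C q₀ = true) ∧
    (C' p = false →
      ∃ S : Set (Fin b × Fin b), IsHStrip S ∧ p ∈ S ∧
        (∀ q ∈ S, C' q = false) ∧ ∃ q₀ ∈ S, C q₀ = false)

/-- A period-R solution of the coloring game on the b×b board: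
(i) C_{(j+1) mod R} follows C_j for every j;
(ii) every column is all-red in some round and every row is all-blue in some round;
(iii) in every round, every column contains a red box and every row a blue box. -/
def IsSolution (b R : ℕ) (C : Fin R → Coloring b) : Prop :=
  (∀ j : Fin R, Follows (C j) (C ⟨(j.val + 1) % R, Nat.mod_lt _ j.pos⟩)) ∧
  (∀ x : Fin b, ∃ j : Fin R, ∀ y : Fin b, C j (x, y) = true) ∧
  (∀ y : Fin b, ∃ j : Fin R, ∀ x : Fin b, C j (x, y) = false) ∧
  (∀ (j : Fin R) (x : Fin b), ∃ y : Fin b, C j (x, y) = true) ∧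
  (∀ (j : Fin R) (y : Fin b), ∃ x : Fin b, C j (x, y) = false)

/-- A criterion for `Follows` quantifying over the endpoints of strips, hence decidable. -/
theorem follows_of_forall_exists_strip {b : ℕ} {C C' : Coloring b}
    (h : ∀ x y : Fin b, C' (x, y) ≠ C (x, y) →
      (C' (x, y) = true → ∃ y₁ y₂ : Fin b, (y₁ ≤ y ∧ y ≤ y₂) ∧
        (∀ v, y₁ ≤ v → v ≤ y₂ → C' (x, v) = true) ∧
        ∃ v, (y₁ ≤ v ∧ v ≤ y₂) ∧ C (x, v) = true) ∧
      (C' (x, y) = false → ∃ x₁ x₂ : Fin b, (x₁ ≤ x ∧ x ≤ x₂) ∧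
        (∀ u, x₁ ≤ u → u ≤ x₂ → C' (u, y) = false) ∧
        ∃ u, (x₁ ≤ u ∧ u ≤ x₂) ∧ C (u, y) = false)) :
    Follows C C' := by
  rintro ⟨x, y⟩ hne
  obtain ⟨hr, hb⟩ := h x y hne
  refine ⟨fun hc => ?_, fun hc => ?_⟩
  · obtain ⟨y₁, y₂, hy, hall, v, hv, hCv⟩ := hr hc
    refine ⟨_, ⟨x, y₁, y₂, rfl⟩, ⟨rfl, hy⟩, ?_, (x, v), ⟨rfl, hv⟩, hCv⟩
    rintro ⟨_, w⟩ ⟨rfl, hw₁, hw₂⟩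
    exact hall w hw₁ hw₂
  · obtain ⟨x₁, x₂, hx, hall, u, hu, hCu⟩ := hb hc
    refine ⟨_, ⟨y, x₁, x₂, rfl⟩, ⟨rfl, hx⟩, ?_, (u, y), ⟨rfl, hu⟩, hCu⟩
    rintro ⟨w, _⟩ ⟨rfl, hw₁, hw₂⟩
    exact hall w hw₁ hw₂

/-- The colors of a period-4 solution on the 4×4 board, indexed by round, column and row. -/
def periodFourColors : Fin 4 → Fin 4 → Fin 4 → Bool :=
  ![![![true, true, false, false], ![true, true, true, true],
      ![false, false, true, true], ![true, true, true, true]],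
    ![![true, false, false, false], ![true, false, false, false],
      ![false, false, false, true], ![false, false, false, true]],
    ![![true, true, true, true], ![true, true, false, false],
      ![true, true, true, true], ![false, false, true, true]],
    ![![false, true, false, false], ![false, true, false, false],
      ![false, false, true, false], ![false, false, true, false]]]

set_option synthInstance.maxSize 1024 in
theorem periodFourColors_isSolution :
    IsSolution 4 4 fun j p => periodFourColors j p.1 p.2 := by
  refine ⟨fun j => follows_of_forall_exists_strip ?_, ?_, ?_, ?_, ?_⟩
  · revert j
    beta_reduce
    decide
  all_goals decide

/-- There exists a period-4 solution of the coloring game on the 4×4 board. -/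
theorem stmt13 : ∃ C : Fin 4 → Coloring 4, IsSolution 4 4 C := by
  exact ⟨_, periodFourColors_isSolution⟩
end

section
/- Let b, R, t be positive integers and let (C_j)_{j < R} be a period-R solution of the coloring game on the b×b board. Define, for each j, the coloring C'_j : Fin (t·b) × Fin (t·b) → Bool by C'_j(x, y) = C_j(x mod b, y mod b). Then (C'_j)_{j < R} is a period-R solution of the coloring game on the (t·b)×(t·b) board. -/
/-- The residue modulo `b` of a coordinate of the tiled board. -/
def tileResidue {t b : ℕ} (hb : 0 < b) (u : Fin (t * b)) : Fin b :=
  ⟨u.val % b, Nat.mod_lt _ hb⟩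

/-- The coordinate with residue `a` in the same tile as `u`. -/
def tileLift {t b : ℕ} (u : Fin (t * b)) (a : Fin b) : Fin (t * b) :=
  ⟨b * (u.val / b) + a.val, by
    have h : u.val / b + 1 ≤ t :=
      Nat.div_lt_of_lt_mul (by rw [Nat.mul_comm b t]; exact u.isLt)
    calc b * (u.val / b) + a.val < b * (u.val / b) + b := by omega
      _ = (u.val / b + 1) * b := by ring
      _ ≤ t * b := Nat.mul_le_mul_right b h⟩

theorem tileResidue_tileLift {t b : ℕ} (hb : 0 < b) (u : Fin (t * b)) (a : Fin b) :
    tileResidue hb (tileLift u a) = a := by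
  ext
  simp [tileResidue, tileLift, Nat.mod_eq_of_lt a.isLt]

theorem tileLift_tileResidue {t b : ℕ} (hb : 0 < b) (u : Fin (t * b)) :
    tileLift u (tileResidue hb u) = u := by
  ext
  exact Nat.div_add_mod u.val b

theorem tileLift_mono {t b : ℕ} (u : Fin (t * b)) {a c : Fin b} (h : a ≤ c) :
    tileLift u a ≤ tileLift u c :=
  Nat.add_le_add_left h _

/-- An interval between two lifts into one tile projects into the original interval. -/
theorem tileResidue_mem_Icc {t b : ℕ} (hb : 0 < b) {u v : Fin (t * b)} {a c : Fin b}
    (h₁ : tileLift u a ≤ v) (h₂ : v ≤ tileLift u c) :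
    a ≤ tileResidue hb v ∧ tileResidue hb v ≤ c := by
  simp only [tileLift, tileResidue, Fin.le_def] at *
  obtain ⟨d, hd⟩ := Nat.exists_eq_add_of_le (le_trans (Nat.le_add_right _ a.val) h₁)
  have hdb : d < b := by omega
  have hv : v.val % b = d := by
    rw [hd, Nat.mul_add_mod, Nat.mod_eq_of_lt hdb]
  omega

/-- Tiling preserves the relation of one coloring following another. -/
theorem Follows.tile {b : ℕ} (t : ℕ) (hb : 0 < b) {C C' : Coloring b} (h : Follows C C') :
    Follows (b := t * b) (fun p => C (tileResidue hb p.1, tileResidue hb p.2))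
      (fun p => C' (tileResidue hb p.1, tileResidue hb p.2)) := by
  rintro ⟨u, v⟩ hne
  obtain ⟨hred, hblue⟩ := h (tileResidue hb u, tileResidue hb v) hne
  constructor
  · intro hp
    obtain ⟨_, ⟨x, y₁, y₂, rfl⟩, ⟨hx, h₁, h₂⟩, hall, ⟨x₀, y₀⟩, ⟨hx₀, h₁₀, h₂₀⟩, hq₀⟩ := hred hp
    dsimp only at hx h₁ h₂ hx₀ h₁₀ h₂₀
    subst hx hx₀
    refine ⟨_, ⟨u, tileLift v y₁, tileLift v y₂, rfl⟩, ⟨rfl, ?_, ?_⟩, ?_,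
      (u, tileLift v y₀), ⟨rfl, tileLift_mono v h₁₀, tileLift_mono v h₂₀⟩, ?_⟩
    · simpa only [tileLift_tileResidue] using tileLift_mono v h₁
    · simpa only [tileLift_tileResidue] using tileLift_mono v h₂
    · rintro ⟨u', v'⟩ ⟨hu, hv₁, hv₂⟩
      exact hall _ ⟨congrArg (tileResidue hb) hu, tileResidue_mem_Icc hb hv₁ hv₂⟩
    · simpa only [tileResidue_tileLift] using hq₀
  · intro hp
    obtain ⟨_, ⟨y, x₁, x₂, rfl⟩, ⟨hy, h₁, h₂⟩, hall, ⟨x₀, y₀⟩, ⟨hy₀, h₁₀, h₂₀⟩, hq₀⟩ := hblue hp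
    dsimp only at hy h₁ h₂ hy₀ h₁₀ h₂₀
    subst hy hy₀
    refine ⟨_, ⟨v, tileLift u x₁, tileLift u x₂, rfl⟩, ⟨rfl, ?_, ?_⟩, ?_,
      (tileLift u x₀, v), ⟨rfl, tileLift_mono u h₁₀, tileLift_mono u h₂₀⟩, ?_⟩
    · simpa only [tileLift_tileResidue] using tileLift_mono u h₁
    · simpa only [tileLift_tileResidue] using tileLift_mono u h₂
    · rintro ⟨u', v'⟩ ⟨hv, hu₁, hu₂⟩
      exact hall _ ⟨congrArg (tileResidue hb) hv, tileResidue_mem_Icc hb hu₁ hu₂⟩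
    · simpa only [tileResidue_tileLift] using hq₀

/-- Tiling a period-R solution of the b×b game t times in each direction yields a
period-R solution of the (t·b)×(t·b) game. -/
theorem stmt14 (b R t : ℕ) (hb : 0 < b) (hR : 0 < R) (ht : 0 < t)
    (C : Fin R → Coloring b) (h : IsSolution b R C) :
    IsSolution (t * b) R (fun j p =>
      C j (⟨p.1.val % b, Nat.mod_lt _ hb⟩, ⟨p.2.val % b, Nat.mod_lt _ hb⟩)) := by
  obtain ⟨hfollow, hred, hblue, hcol, hrow⟩ := h
  refine ⟨fun j => (hfollow j).tile t hb, fun x => ?_, fun y => ?_, fun j x => ?_, fun j y => ?_⟩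
  · obtain ⟨j, hj⟩ := hred (tileResidue hb x)
    exact ⟨j, fun y => hj (tileResidue hb y)⟩
  · obtain ⟨j, hj⟩ := hblue (tileResidue hb y)
    exact ⟨j, fun x => hj (tileResidue hb x)⟩
  · obtain ⟨y, hy⟩ := hcol j (tileResidue hb x)
    refine ⟨tileLift x y, ?_⟩
    change C j (tileResidue hb x, tileResidue hb (tileLift x y)) = true
    rwa [tileResidue_tileLift]
  · obtain ⟨x, hx⟩ := hrow j (tileResidue hb y)
    refine ⟨tileLift y x, ?_⟩
    change C j (tileResidue hb (tileLift y x), tileResidue hb y) = false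
    rwa [tileResidue_tileLift]
end

section
/- For every positive integer t, there exists a period-4 solution of the coloring game on the (4·t)×(4·t) board. -/
/-- The pullback of a coloring along a map of the coordinates. -/
def Coloring.pullback {b b' : ℕ} (f : Fin b' → Fin b) (C : Coloring b) : Coloring b' :=
  fun p => C (f p.1, f p.2)

theorem Follows.pullback {b b' : ℕ} {f : Fin b' → Fin b} (hf : Monotone f)
    (hs : Function.Surjective f) {C C' : Coloring b} (h : Follows C C') :
    Follows (C.pullback f) (C'.pullback f) := by
  rintro ⟨x, y⟩ hp
  obtain ⟨hred, hblue⟩ := h (f x, f y) hp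
  refine ⟨fun hc => ?_, fun hc => ?_⟩
  · obtain ⟨_, ⟨x₀, y₁, y₂, rfl⟩, ⟨hx, hy₁, hy₂⟩, hall, ⟨a, z⟩, ⟨ha, hz₁, hz₂⟩, hq⟩ := hred hc
    obtain ⟨z, rfl⟩ := hs z
    dsimp only at hx hy₁ hy₂ ha hz₁ hz₂
    subst hx ha
    refine ⟨_, ⟨x, min y z, max y z, rfl⟩, ⟨rfl, min_le_left _ _, le_max_left _ _⟩, ?_,
      (x, z), ⟨rfl, min_le_right _ _, le_max_right _ _⟩, hq⟩
    rintro ⟨_, w⟩ ⟨rfl, hw₁, hw₂⟩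
    refine hall _ ⟨rfl, le_trans ?_ (hf hw₁), (hf hw₂).trans ?_⟩
    · rw [hf.map_min]; exact le_min hy₁ hz₁
    · rw [hf.map_max]; exact max_le hy₂ hz₂
  · obtain ⟨_, ⟨y₀, x₁, x₂, rfl⟩, ⟨hy, hx₁, hx₂⟩, hall, ⟨z, a⟩, ⟨ha, hz₁, hz₂⟩, hq⟩ := hblue hc
    obtain ⟨z, rfl⟩ := hs z
    dsimp only at hy hx₁ hx₂ ha hz₁ hz₂
    subst hy ha
    refine ⟨_, ⟨y, min x z, max x z, rfl⟩, ⟨rfl, min_le_left _ _, le_max_left _ _⟩, ?_,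
      (z, y), ⟨rfl, min_le_right _ _, le_max_right _ _⟩, hq⟩
    rintro ⟨w, _⟩ ⟨rfl, hw₁, hw₂⟩
    refine hall _ ⟨rfl, le_trans ?_ (hf hw₁), (hf hw₂).trans ?_⟩
    · rw [hf.map_min]; exact le_min hx₁ hz₁
    · rw [hf.map_max]; exact max_le hx₂ hz₂

theorem IsSolution.pullback {b b' R : ℕ} {f : Fin b' → Fin b} (hf : Monotone f)
    (hs : Function.Surjective f) {C : Fin R → Coloring b} (h : IsSolution b R C) :
    IsSolution b' R fun j => (C j).pullback f := by
  obtain ⟨hfol, hcol, hrow, hred, hblue⟩ := h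
  refine ⟨fun j => (hfol j).pullback hf hs, fun x => ?_, fun y => ?_, fun j x => ?_, fun j y => ?_⟩
  · obtain ⟨j, hj⟩ := hcol (f x)
    exact ⟨j, fun y => hj (f y)⟩
  · obtain ⟨j, hj⟩ := hrow (f y)
    exact ⟨j, fun x => hj (f x)⟩
  · obtain ⟨y, hy⟩ := hred j (f x)
    obtain ⟨y, rfl⟩ := hs y
    exact ⟨y, hy⟩
  · obtain ⟨x, hx⟩ := hblue j (f y)
    obtain ⟨x, rfl⟩ := hs x
    exact ⟨x, hx⟩

/-- A form of `Follows` that quantifies over endpoints of strips only, hence is decidable. -/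
theorem Follows.of_endpoints {b : ℕ} {C C' : Coloring b}
    (h : ∀ x y : Fin b, C' (x, y) ≠ C (x, y) →
      (C' (x, y) = true → ∃ z, C (x, z) = true ∧
        ∀ w, min y z ≤ w → w ≤ max y z → C' (x, w) = true) ∧
      (C' (x, y) = false → ∃ z, C (z, y) = false ∧
        ∀ w, min x z ≤ w → w ≤ max x z → C' (w, y) = false)) :
    Follows C C' := by
  rintro ⟨x, y⟩ hp
  refine ⟨fun hc => ?_, fun hc => ?_⟩
  · obtain ⟨z, hz, hw⟩ := (h x y hp).1 hc
    refine ⟨_, ⟨x, min y z, max y z, rfl⟩, ⟨rfl, min_le_left _ _, le_max_left _ _⟩, ?_,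
      (x, z), ⟨rfl, min_le_right _ _, le_max_right _ _⟩, hz⟩
    rintro ⟨_, w⟩ ⟨rfl, hw₁, hw₂⟩
    exact hw w hw₁ hw₂
  · obtain ⟨z, hz, hw⟩ := (h x y hp).2 hc
    refine ⟨_, ⟨y, min x z, max x z, rfl⟩, ⟨rfl, min_le_left _ _, le_max_left _ _⟩, ?_,
      (z, y), ⟨rfl, min_le_right _ _, le_max_right _ _⟩, hz⟩
    rintro ⟨w, _⟩ ⟨rfl, hw₁, hw₂⟩
    exact hw w hw₁ hw₂

/-- A period-4 sequence of colorings of the 4×4 board, each listed row by row (`1` is red). -/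
def fourByFour (j : Fin 4) : Coloring 4 := fun p =>
  (![![![0, 1, 1, 1],
       ![0, 1, 1, 1],
       ![1, 1, 0, 1],
       ![1, 1, 0, 1]],
     ![![0, 0, 1, 1],
       ![0, 0, 0, 0],
       ![0, 0, 0, 0],
       ![1, 1, 0, 0]],
     ![![1, 0, 1, 1],
       ![1, 0, 1, 1],
       ![1, 1, 1, 0],
       ![1, 1, 1, 0]],
     ![![0, 0, 0, 0],
       ![0, 0, 1, 1],
       ![1, 1, 0, 0],
       ![0, 0, 0, 0]]] : Fin 4 → Fin 4 → Fin 4 → Fin 2) j p.2 p.1 == 1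

theorem isSolution_fourByFour : IsSolution 4 4 fourByFour := by
  refine ⟨fun j => Follows.of_endpoints ?_, by decide, by decide, by decide, by decide⟩
  revert j
  set_option maxRecDepth 10000 in decide

/-- For every positive t, there is a period-4 solution of the coloring game on the
(4·t)×(4·t) board. -/
theorem stmt15 (t : ℕ) (ht : 0 < t) :
    ∃ C : Fin 4 → Coloring (4 * t), IsSolution (4 * t) 4 C := by
  let f : Fin (4 * t) → Fin 4 := fun i =>
    ⟨i / t, (Nat.div_lt_iff_lt_mul ht).2 i.isLt⟩
  refine ⟨_, isSolution_fourByFour.pullback (f := f) (fun i j hij => ?_) fun k => ?_⟩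
  · exact Nat.div_le_div_right hij
  · exact ⟨⟨k * t, Nat.mul_lt_mul_of_pos_right k.isLt ht⟩, Fin.ext (Nat.mul_div_cancel _ ht)⟩
end
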